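/- Let A be a J-algebra and a, b ∈ A with a˘;a ≤ 1', b˘;b ≤ 1', 1 = a˘;b, 1 = a;1 = b;1, and (a;a˘)·(b;b˘) ≤ 1'. Define A₁ = a;a˘;a˘ · b;a;b˘;a˘ · b;b;b˘, B₁ = a;a˘ · b;a;a˘;a˘;b˘ · b;b;a;b˘;a˘;b˘ · b;b;b;b˘;b˘, C₁ = a;b˘;b˘ · b;a;a˘ · b;b;a˘;b˘, X₂ = A₁;B₁;A₁˘, C₂ = B₁;C₁;A₁˘, and C₃ = B₁;B₁;C₁;A₁˘;A₁˘. Then the four remaining relations in the presentation of Thompson's group T hold: C₁ = C₂;B₁, X₂;C₂ = C₃;B₁, A₁;C₁ = C₂;C₂, and C₁;C₁;C₁ = 1'. -/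

import Mathlib

/-- A J-algebra: an algebra (A, ·, 0, 1, ;, ˘, 1') satisfying Jónsson's axioms. -/
structure JAlgebra (A : Type*) where
  meet : A → A → A        -- Boolean product ·
  comp : A → A → A        -- relative product ;
  conv : A → A            -- converse ˘
  zero : A                -- 0
  one : A                 -- 1
  ident : A               -- 1'
  massoc : ∀ x y z, meet x (meet y z) = meet (meet x y) z
  mcomm : ∀ x y, meet x y = meet y x
  midem : ∀ x, meet x x = x
  cassoc : ∀ x y z, comp x (comp y z) = comp (comp x y) z
  cid : ∀ x, comp x ident = x
  semidist : ∀ x y z, comp (meet x y) z = meet (comp (meet x y) z) (comp y z)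
  convconv : ∀ x, conv (conv x) = x
  convcomp : ∀ x y, conv (comp x y) = comp (conv y) (conv x)
  convmeet : ∀ x y, conv (meet x y) = meet (conv x) (conv y)
  rot : ∀ x y z, meet (comp x y) z =
    meet (comp (meet (comp z (conv y)) x) (meet y (comp (conv x) z))) z
  zbot : ∀ x, meet zero x = zero
  otop : ∀ x, meet x one = x
  comp_zero : ∀ x, comp x zero = zero

/-- x ≤ y iff x·y = x. -/
def JAlgebra.le {A : Type*} (J : JAlgebra A) (x y : A) : Prop := J.meet x y = x

/-- x is functional iff x˘;x ≤ 1'. -/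
def JAlgebra.Functional {A : Type*} (J : JAlgebra A) (x : A) : Prop :=
  J.le (J.comp (J.conv x) x) J.ident

/-- x is permutational iff x;x˘ = 1' = x˘;x. -/
def JAlgebra.Permutational {A : Type*} (J : JAlgebra A) (x : A) : Prop :=
  J.comp x (J.conv x) = J.ident ∧ J.comp (J.conv x) x = J.ident

namespace JAlgebra

variable {A : Type*} (J : JAlgebra A)

lemma le_refl (x : A) : J.le x x := J.midem x

variable {J}

lemma le_trans {x y z : A} (h : J.le x y) (k : J.le y z) : J.le x z := by
  unfold le at *
  rw [← h, ← J.massoc, k]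

lemma le_antisymm {x y : A} (h : J.le x y) (k : J.le y x) : x = y := by
  unfold le at *
  rw [← h, J.mcomm, k]

variable (J) in
lemma meet_le_right (x y : A) : J.le (J.meet x y) y := by
  unfold le
  rw [← J.massoc, J.midem]

variable (J) in
lemma meet_le_left (x y : A) : J.le (J.meet x y) x := by
  rw [J.mcomm]
  exact J.meet_le_right y x

lemma le_meet {x y z : A} (h : J.le x y) (k : J.le x z) : J.le x (J.meet y z) := by
  unfold le at *
  rw [J.massoc, h, k]

lemma meet_mono {x y z w : A} (h : J.le x y) (k : J.le z w) :
    J.le (J.meet x z) (J.meet y w) :=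
  le_meet (le_trans (J.meet_le_left x z) h) (le_trans (J.meet_le_right x z) k)

lemma le_one (x : A) : J.le x J.one := J.otop x

lemma conv_mono {x y : A} (h : J.le x y) : J.le (J.conv x) (J.conv y) := by
  unfold le at *
  rw [← J.convmeet, h]

variable (J) in
lemma conv_ident : J.conv J.ident = J.ident := by
  have h := J.convcomp (J.conv J.ident) J.ident
  rw [J.cid, J.convconv, J.cid] at h
  exact h.symm

variable (J) in
lemma ident_comp (x : A) : J.comp J.ident x = x := by
  have h := J.convcomp (J.conv x) J.ident
  rwa [J.cid, J.convconv, J.conv_ident, eq_comm] at h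

variable (J) in
lemma conv_one : J.conv J.one = J.one := by
  refine le_antisymm (le_one _) ?_
  have h := conv_mono (le_one (J := J) (J.conv J.one))
  rwa [J.convconv] at h

lemma comp_mono_left {x y : A} (h : J.le x y) (z : A) : J.le (J.comp x z) (J.comp y z) := by
  have k := J.semidist x y z
  rw [show J.meet x y = x from h] at k
  exact k.symm

lemma comp_mono_right (z : A) {x y : A} (h : J.le x y) : J.le (J.comp z x) (J.comp z y) := by
  have k := conv_mono (comp_mono_left (conv_mono h) (J.conv z))
  simpa only [J.convcomp, J.convconv] using k

lemma comp_mono {x y z w : A} (h : J.le x y) (k : J.le z w) :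
    J.le (J.comp x z) (J.comp y w) :=
  le_trans (comp_mono_left h z) (comp_mono_right y k)

variable (J) in
/-- The Dedekind law. -/
lemma dedekind (x y z : A) : J.le (J.meet (J.comp x y) z)
    (J.comp (J.meet (J.comp z (J.conv y)) x) (J.meet y (J.comp (J.conv x) z))) := by
  rw [J.rot]
  exact J.meet_le_left _ _

lemma Functional.comp_meet {f : A} (hf : J.Functional f) (x y : A) :
    J.comp f (J.meet x y) = J.meet (J.comp f x) (J.comp f y) := by
  refine le_antisymm (le_meet (comp_mono_right f (J.meet_le_left x y))
    (comp_mono_right f (J.meet_le_right x y))) (le_trans (J.dedekind _ _ _) ?_)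
  refine comp_mono (J.meet_le_right _ _) (meet_mono (J.le_refl x) ?_)
  rw [J.cassoc]
  have h := comp_mono_left hf y
  rwa [J.ident_comp] at h

lemma Functional.meet_comp_conv {f : A} (hf : J.Functional f) (x y : A) :
    J.comp (J.meet x y) (J.conv f) = J.meet (J.comp x (J.conv f)) (J.comp y (J.conv f)) := by
  have h := congrArg J.conv (hf.comp_meet (J.conv x) (J.conv y))
  simpa only [J.convcomp, J.convconv, J.convmeet] using h

/-- A total functional element. -/
def IsMap (J : JAlgebra A) (x : A) : Prop :=
  J.Functional x ∧ J.comp x J.one = J.one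

variable (J) in
lemma isMap_ident : J.IsMap J.ident := by
  refine ⟨?_, J.ident_comp _⟩
  unfold Functional
  rw [J.conv_ident, J.cid]
  exact J.le_refl _

lemma IsMap.comp {f g : A} (hf : J.IsMap f) (hg : J.IsMap g) : J.IsMap (J.comp f g) := by
  refine ⟨?_, by rw [← J.cassoc, hg.2, hf.2]⟩
  unfold Functional
  rw [J.convcomp, J.cassoc, ← J.cassoc (J.conv g)]
  refine le_trans (comp_mono_left (comp_mono_right _ hf.1) _) ?_
  rw [J.cid]
  exact hg.1

lemma IsMap.ident_le {f : A} (hf : J.IsMap f) : J.le J.ident (J.comp f (J.conv f)) := by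
  have h := J.dedekind f J.one J.ident
  rw [hf.2, J.mcomm, J.otop, J.cid] at h
  exact le_trans h (comp_mono (J.meet_le_right _ _) (J.meet_le_right _ _))

/-- Mutually inverse functional elements are converses of each other. -/
lemma conv_eq_of_inverse {f g : A} (hf : J.Functional f) (hg : J.Functional g)
    (hfg : J.comp f g = J.ident) (hgf : J.comp g f = J.ident) : J.conv f = g := by
  have key : ∀ {x y : A}, J.Functional x → J.comp x y = J.ident → J.le (J.conv x) y := by
    intro x y hx hxy
    have h := comp_mono_left hx y
    rwa [← J.cassoc, hxy, J.cid, J.ident_comp] at h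
  refine le_antisymm (key hf hfg) ?_
  have h := conv_mono (key hg hgf)
  rwa [J.convconv] at h

/-- The monoid of total functional elements of a J-algebra. -/
def Maps (J : JAlgebra A) : Type _ := {x : A // J.IsMap x}

instance : Monoid J.Maps where
  mul f g := ⟨J.comp f.1 g.1, f.2.comp g.2⟩
  one := ⟨J.ident, J.isMap_ident⟩
  mul_assoc f g h := Subtype.ext (J.cassoc f.1 g.1 h.1).symm
  one_mul f := Subtype.ext (J.ident_comp f.1)
  mul_one f := Subtype.ext (J.cid f.1)

/-- Total functional elements that are the projections of a bijection with pairs. -/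
structure IsProjections (J : JAlgebra A) (a b : A) : Prop where
  left : J.IsMap a
  right : J.IsMap b
  exists_pair : J.one = J.comp (J.conv a) b
  unique : J.le (J.meet (J.comp a (J.conv a)) (J.comp b (J.conv b))) J.ident

/-- The pairing of two elements with respect to the projections `a` and `b`. -/
def pair (J : JAlgebra A) (a b x y : A) : A :=
  J.meet (J.comp x (J.conv a)) (J.comp y (J.conv b))

namespace IsProjections

variable {a b : A} (h : J.IsProjections a b)
include h

lemma swap : J.IsProjections b a := by
  refine ⟨h.right, h.left, ?_, by rw [J.mcomm]; exact h.unique⟩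
  have k := congrArg J.conv h.exists_pair
  rwa [J.conv_one, J.convcomp, J.convconv] at k

lemma pair_comp_left {y : A} (x : A) (hy : J.IsMap y) : J.comp (J.pair a b x y) a = x := by
  refine le_antisymm (le_trans (comp_mono_left (J.meet_le_left _ _) a) ?_) ?_
  · rw [← J.cassoc]
    have k := comp_mono_right x h.left.1
    rwa [J.cid] at k
  · have k := J.dedekind (J.comp y (J.conv b)) a x
    rw [← J.cassoc, ← h.swap.exists_pair, hy.2, J.mcomm, J.otop] at k
    exact le_trans k (comp_mono_right _ (J.meet_le_left _ _))

lemma pair_comp_right {x : A} (hx : J.IsMap x) (y : A) : J.comp (J.pair a b x y) b = y := by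
  have k := h.swap.pair_comp_left y hx
  rwa [pair, J.mcomm] at k

lemma isMap_pair {x y : A} (hx : J.IsMap x) (hy : J.IsMap y) : J.IsMap (J.pair a b x y) := by
  have key : ∀ {c z : A}, J.IsMap z → J.le (J.comp (J.comp c (J.conv z)) (J.comp z (J.conv c)))
      (J.comp c (J.conv c)) := by
    intro c z hz
    rw [J.cassoc, ← J.cassoc c]
    have k := comp_mono_left (comp_mono_right c hz.1) (J.conv c)
    rwa [J.cid] at k
  constructor
  · refine le_trans (le_meet ?_ ?_) h.unique
    · refine le_trans (comp_mono (conv_mono (J.meet_le_left _ _)) (J.meet_le_left _ _)) ?_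
      rw [J.convcomp, J.convconv]
      exact key hx
    · refine le_trans (comp_mono (conv_mono (J.meet_le_right _ _)) (J.meet_le_right _ _)) ?_
      rw [J.convcomp, J.convconv]
      exact key hy
  · rw [← h.left.2, J.cassoc, h.pair_comp_left x hy, hx.2, h.left.2]

lemma pair_self : J.pair a b a b = J.ident :=
  le_antisymm h.unique (le_meet h.left.ident_le h.right.ident_le)

omit h in
lemma comp_pair {f : A} (hf : J.IsMap f) (x y : A) :
    J.comp f (J.pair a b x y) = J.pair a b (J.comp f x) (J.comp f y) := by
  rw [pair, hf.1.comp_meet, J.cassoc, J.cassoc, pair]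

end IsProjections

end JAlgebra

/-- The relations of Thompson's group `T` hold in every monoid with a surjective pairing. -/
lemma thompson_relations_of_pairing {M : Type*} [Monoid M] (a b : M) (p : M → M → M)
    (hpa : ∀ x y, p x y * a = x) (hpb : ∀ x y, p x y * b = y)
    (hmul : ∀ f x y, f * p x y = p (f * x) (f * y)) (hself : p a b = 1)
    (A A' B C C₂ : M)
    (hA : A = p (p a (b * a)) (b * b))
    (hA' : A' = p (a * a) (p (a * b) b))
    (hB : B = p a (p (p (b * a) (b * b * a)) (b * b * b)))
    (hC : C = p (b * a) (p (b * b) a))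
    (hC₂ : C₂ = B * C * A') :
    (A * A' = 1 ∧ A' * A = 1) ∧
    C = C₂ * B ∧
    A * B * A' * C₂ = B * B * C * A' * A' * B ∧
    A * C = C₂ * C₂ ∧
    C * C * C = 1 := by
  have hpa' : ∀ x y z, p x y * (a * z) = x * z := fun x y z => by rw [← mul_assoc, hpa]
  have hpb' : ∀ x y z, p x y * (b * z) = y * z := fun x y z => by rw [← mul_assoc, hpb]
  have heta : ∀ x, p (x * a) (x * b) = x := fun x => by rw [← hmul, hself, mul_one]
  have heta' : ∀ x y, p (x * (y * a)) (x * (y * b)) = x * y := fun x y => by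
    rw [← hmul, ← hmul, hself, mul_one]
  subst hC₂ hA hA' hB hC
  refine ⟨⟨?_, ?_⟩, ?_, ?_, ?_, ?_⟩ <;>
    simp only [mul_assoc, hpa, hpb, hpa', hpb', hmul, hself, heta, heta']

/-- Under (Q), (D), (U), the elements A₁, B₁, C₁ satisfy the four remaining
relations in the presentation of Thompson's group T. -/
theorem thompson_T_relations {A : Type*} (J : JAlgebra A) (a b : A)
    (ha : J.le (J.comp (J.conv a) a) J.ident)
    (hb : J.le (J.comp (J.conv b) b) J.ident)
    (hQ : J.one = J.comp (J.conv a) b)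
    (hDa : J.one = J.comp a J.one)
    (hDb : J.one = J.comp b J.one)
    (hU : J.le (J.meet (J.comp a (J.conv a)) (J.comp b (J.conv b))) J.ident)
    (A₁ B₁ C₁ X₂ C₂ C₃ : A)
    (hA₁ : A₁ = J.meet (J.meet (J.comp (J.comp a (J.conv a)) (J.conv a))
                  (J.comp (J.comp (J.comp b a) (J.conv b)) (J.conv a)))
                (J.comp (J.comp b b) (J.conv b)))
    (hB₁ : B₁ = J.meet (J.meet (J.meet (J.comp a (J.conv a))
                  (J.comp (J.comp (J.comp (J.comp b a) (J.conv a)) (J.conv a)) (J.conv b)))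
                  (J.comp (J.comp (J.comp (J.comp (J.comp b b) a) (J.conv b)) (J.conv a)) (J.conv b)))
                (J.comp (J.comp (J.comp (J.comp b b) b) (J.conv b)) (J.conv b)))
    (hC₁ : C₁ = J.meet (J.meet (J.comp (J.comp a (J.conv b)) (J.conv b))
                  (J.comp (J.comp b a) (J.conv a)))
                (J.comp (J.comp (J.comp b b) (J.conv a)) (J.conv b)))
    (hX₂ : X₂ = J.comp (J.comp A₁ B₁) (J.conv A₁))
    (hC₂ : C₂ = J.comp (J.comp B₁ C₁) (J.conv A₁))
    (hC₃ : C₃ = J.comp (J.comp (J.comp (J.comp B₁ B₁) C₁) (J.conv A₁)) (J.conv A₁)) :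
    C₁ = J.comp C₂ B₁ ∧
    J.comp X₂ C₂ = J.comp C₃ B₁ ∧
    J.comp A₁ C₁ = J.comp C₂ C₂ ∧
    J.comp (J.comp C₁ C₁) C₁ = J.ident := by
  have ha' : J.IsMap a := ⟨ha, hDa.symm⟩
  have hb' : J.IsMap b := ⟨hb, hDb.symm⟩
  have h : J.IsProjections a b := ⟨ha', hb', hQ, hU⟩
  let p : J.Maps → J.Maps → J.Maps := fun x y => ⟨J.pair a b x.1 y.1, h.isMap_pair x.2 y.2⟩
  let α : J.Maps := ⟨a, ha'⟩
  let β : J.Maps := ⟨b, hb'⟩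
  let S : J.Maps := p (p α (β * α)) (β * β)
  let S' : J.Maps := p (α * α) (p (α * β) β)
  let T : J.Maps := p α (p (p (β * α) (β * β * α)) (β * β * β))
  let U : J.Maps := p (β * α) (p (β * β) α)
  obtain ⟨⟨hSS', hS'S⟩, h1, h2, h3, h4⟩ := thompson_relations_of_pairing α β p
    (fun x y => Subtype.ext (h.pair_comp_left x.1 y.2))
    (fun x y => Subtype.ext (h.pair_comp_right x.2 y.1))
    (fun f x y => Subtype.ext (JAlgebra.IsProjections.comp_pair f.2 x.1 y.1))
    (Subtype.ext h.pair_self) S S' T U _ rfl rfl rfl rfl rfl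
  have hda := JAlgebra.Functional.meet_comp_conv (J := J) ha
  have hdb := JAlgebra.Functional.meet_comp_conv (J := J) hb
  have eA : A₁ = S.1 := by
    change A₁ = J.pair a b (J.pair a b a (J.comp b a)) (J.comp b b)
    simp only [hA₁, JAlgebra.pair, hda]
  have eB : B₁ = T.1 := by
    change B₁ = J.pair a b a (J.pair a b (J.pair a b (J.comp b a) (J.comp (J.comp b b) a))
      (J.comp (J.comp b b) b))
    simp only [hB₁, JAlgebra.pair, hda, hdb, J.massoc]
  have eC : C₁ = U.1 := by
    change C₁ = J.pair a b (J.comp b a) (J.pair a b (J.comp b b) a)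
    rw [hC₁, ← J.massoc, J.mcomm, ← J.massoc]
    simp only [JAlgebra.pair, hdb]
  have eA' : J.conv A₁ = S'.1 := by
    rw [eA]
    exact JAlgebra.conv_eq_of_inverse S.2.1 S'.2.1 (congrArg Subtype.val hSS')
      (congrArg Subtype.val hS'S)
  rw [eA'] at hX₂ hC₂ hC₃
  rw [hX₂, hC₂, hC₃, eA, eB, eC]
  exact ⟨congrArg Subtype.val h1, congrArg Subtype.val h2, congrArg Subtype.val h3,
    congrArg Subtype.val h4⟩
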